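/- arXiv:2310.02075 — 3 statements merged into one kernel-verified Lean document; each statement's English description precedes it below -/
import Mathlib

section
/- Let N ≥ 2. For every matrix A ∈ M_{N²}(ℂ) (indexed by pairs of indices in {1,…,N}), the second moment of conjugation by a Haar-random unitary satisfies ∫_{U(N)} (U ⊗ U) A (U ⊗ U)† dμ_H(U) = c_I · I_{N²} + c_F · 𝔽, where c_I = (tr(A) − tr(𝔽A)/N)/(N² − 1) and c_F = (tr(𝔽A) − tr(A)/N)/(N² − 1). -/
open MeasureTheory Matrix
open scoped Kronecker

attribute [local instance] Matrix.frobeniusNormedAddCommGroup Matrix.frobeniusNormedSpace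

/-- The Borel measurable-space structure on matrices (the product σ-algebra). -/
instance matrixMeasurableSpace {m n α : Type*} [MeasurableSpace α] :
    MeasurableSpace (Matrix m n α) :=
  inferInstanceAs (MeasurableSpace (m → n → α))

noncomputable section

/-- The flip (swap) operator `𝔽` on `ℂ^N ⊗ ℂ^N`, as an `N² × N²` matrix indexed by pairs:
`𝔽_{(i,j),(k,l)} = 1` if `i = l` and `j = k`, and `0` otherwise. -/
def flipOp (N : ℕ) : Matrix (Fin N × Fin N) (Fin N × Fin N) ℂ :=
  Matrix.of fun p q => if p.1 = q.2 ∧ p.2 = q.1 then 1 else 0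

section Commutant

variable {n : Type*} [DecidableEq n]

/-- The Lie algebra action `X ↦ X ⊗ 1 + 1 ⊗ X` on the tensor square. -/
def kroneckerDeriv (X : Matrix n n ℂ) : Matrix (n × n) (n × n) ℂ :=
  X ⊗ₖ (1 : Matrix n n ℂ) + (1 : Matrix n n ℂ) ⊗ₖ X

lemma kroneckerDeriv_add (X Y : Matrix n n ℂ) :
    kroneckerDeriv (X + Y) = kroneckerDeriv X + kroneckerDeriv Y := by
  simp only [kroneckerDeriv, add_kronecker, kronecker_add]
  abel

lemma kroneckerDeriv_smul (c : ℂ) (X : Matrix n n ℂ) :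
    kroneckerDeriv (c • X) = c • kroneckerDeriv X := by
  simp only [kroneckerDeriv, smul_kronecker, kronecker_smul, smul_add]

lemma one_add_smul_kronecker_self (P : Matrix n n ℂ) (z : ℂ) :
    (1 + z • P) ⊗ₖ (1 + z • P) = 1 + z • kroneckerDeriv P + (z * z) • (P ⊗ₖ P) := by
  simp only [kroneckerDeriv, add_kronecker, kronecker_add, smul_kronecker, kronecker_smul,
    one_kronecker_one, smul_add, smul_smul]
  abel

variable [Fintype n]

lemma one_add_smul_mem_unitaryGroup {P : Matrix n n ℂ} (hP : P * P = P) (hP' : Pᴴ = P) {z : ℂ}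
    (hz : z + star z + z * star z = 0) : 1 + z • P ∈ Matrix.unitaryGroup n ℂ := by
  rw [Matrix.mem_unitaryGroup_iff, star_eq_conjTranspose, conjTranspose_add, conjTranspose_smul,
    hP', conjTranspose_one, add_mul, mul_add, mul_add, smul_mul_smul_comm, hP, one_mul, one_mul,
    mul_one]
  have h : (z + star z + z * star z) • P = 0 := by rw [hz, zero_smul]
  rw [add_smul, add_smul] at h
  calc _ = 1 + (z • P + star z • P + (z * star z) • P) := by abel
    _ = 1 := by rw [h, add_zero]

variable {T : Matrix (n × n) (n × n) ℂ}

lemma commute_kroneckerDeriv_of_projection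
    (hT : ∀ V ∈ Matrix.unitaryGroup n ℂ, Commute T (V ⊗ₖ V))
    {P : Matrix n n ℂ} (hP : P * P = P) (hP' : Pᴴ = P) : Commute T (kroneckerDeriv P) := by
  have key : ∀ z : ℂ, z + star z + z * star z = 0 →
      z • (T * kroneckerDeriv P - kroneckerDeriv P * T)
        + (z * z) • (T * (P ⊗ₖ P) - (P ⊗ₖ P) * T) = 0 := by
    intro z hz
    have h := (hT _ (one_add_smul_mem_unitaryGroup hP hP' hz)).eq
    rw [one_add_smul_kronecker_self] at h
    simp only [mul_add, add_mul, mul_one, one_mul, mul_smul_comm, smul_mul_assoc] at h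
    rw [← sub_eq_zero] at h
    rw [← h]
    simp only [smul_sub]
    abel
  have h1 := key (-2) (by norm_num)
  have h2 := key (-1 + Complex.I) (by
    apply Complex.ext <;> norm_num)
  have hII := Complex.I_mul_I
  rw [Commute, SemiconjBy, ← sub_eq_zero]
  ext p q
  have e1 := congrFun (congrFun h1 p) q
  have e2 := congrFun (congrFun h2 p) q
  rw [Matrix.add_apply, Matrix.smul_apply, Matrix.smul_apply, smul_eq_mul, smul_eq_mul,
    Matrix.zero_apply] at e1 e2
  rw [Matrix.zero_apply]
  linear_combination (-Complex.I / 2) * e1 - e2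
    + (T * (P ⊗ₖ P) - (P ⊗ₖ P) * T) p q * hII

lemma commute_kroneckerDeriv_single
    (hT : ∀ V ∈ Matrix.unitaryGroup n ℂ, Commute T (V ⊗ₖ V)) (a b : n) :
    Commute T (kroneckerDeriv (single a b 1)) := by
  have hdiag : ∀ a, Commute T (kroneckerDeriv (single a a 1)) := fun a =>
    commute_kroneckerDeriv_of_projection hT (by simp) (by simp)
  rcases eq_or_ne a b with rfl | hab
  · exact hdiag a
  have hproj : ∀ c : ℂ, star c * c = 1 → Commute T (kroneckerDeriv ((1 / 2 : ℂ) •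
      (single a a 1 + single b b 1 + (star c) • single a b 1 + c • single b a 1))) := by
    intro c hc
    apply commute_kroneckerDeriv_of_projection hT
    · simp only [mul_add, add_mul, smul_mul_assoc, mul_smul_comm,
        single_mul_single_same, single_mul_single_of_ne _ _ _ _ hab,
        single_mul_single_of_ne _ _ _ _ hab.symm, smul_smul, mul_one, smul_zero]
      match_scalars
      · linear_combination (1 / 4 : ℂ) * hc
      · ring
      · linear_combination (1 / 4 : ℂ) * hc
      · ring
    · simp only [conjTranspose_smul, conjTranspose_add, conjTranspose_single, star_one, star_star]
      rw [show star (1 / 2 : ℂ) = 1 / 2 by simp]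
      congr 1
      abel
  have h1 := hproj 1 (by simp)
  have h2 := hproj Complex.I (by simp)
  have hE : single a b (1 : ℂ) = (1 : ℂ) • ((1 / 2 : ℂ) •
      (single a a 1 + single b b 1 + (star (1 : ℂ)) • single a b 1 + (1 : ℂ) • single b a 1))
      + (Complex.I • ((1 / 2 : ℂ) • (single a a 1 + single b b 1 + (star Complex.I) • single a b 1
        + Complex.I • single b a 1))
      + (-(1 + Complex.I) / 2) • (single a a 1 + single b b 1)) := by
    have hII := Complex.I_mul_I
    rw [show star Complex.I = -Complex.I from Complex.conj_I, star_one]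
    match_scalars
    · linear_combination (1 / 2 : ℂ) * hII
    · ring
    · ring
    · linear_combination (-1 / 2 : ℂ) * hII
  rw [hE]
  simp only [kroneckerDeriv_add, kroneckerDeriv_smul] at h1 h2 ⊢
  exact (h1.smul_right _).add_right ((h2.smul_right _).add_right
    (((hdiag a).add_right (hdiag b)).smul_right _))

lemma commutant_entry_relation
    (hT : ∀ V ∈ Matrix.unitaryGroup n ℂ, Commute T (V ⊗ₖ V)) (a b i j k l : n) :
    (if b = k then T (i, j) (a, l) else 0) + (if b = l then T (i, j) (k, a) else 0)
      = (if a = i then T (b, j) (k, l) else 0) + (if a = j then T (i, b) (k, l) else 0) := by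
  have h := congrFun (congrFun (commute_kroneckerDeriv_single hT a b).eq (i, j)) (k, l)
  simp only [kroneckerDeriv, mul_add, add_mul, Matrix.add_apply, Matrix.mul_apply,
    Fintype.sum_prod_type, kroneckerMap_apply, single_apply, Matrix.one_apply, ite_and, mul_ite,
    Finset.sum_add_distrib,
    ite_mul, mul_one, one_mul, mul_zero, zero_mul, Finset.sum_ite_irrel, Finset.sum_ite_eq,
    Finset.sum_ite_eq', Finset.mem_univ, if_true, Finset.sum_const_zero] at h
  simpa [eq_comm] using h

end Commutant

/-- A matrix commuting with every `V ⊗ V`, `V` unitary, is a combination of the identity and the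
flip, with coefficients determined by its traces. -/
lemma eq_smul_one_add_smul_flipOp_of_commute {N : ℕ} (hN : 2 ≤ N)
    {T : Matrix (Fin N × Fin N) (Fin N × Fin N) ℂ}
    (hT : ∀ V ∈ Matrix.unitaryGroup (Fin N) ℂ, Commute T (V ⊗ₖ V)) :
    T = ((T.trace - (flipOp N * T).trace / (N : ℂ)) / ((N : ℂ) ^ 2 - 1)) •
          (1 : Matrix (Fin N × Fin N) (Fin N × Fin N) ℂ)
        + (((flipOp N * T).trace - T.trace / (N : ℂ)) / ((N : ℂ) ^ 2 - 1)) • flipOp N := by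
  have rel := commutant_entry_relation hT
  have h1 : ∀ i j a l, (N : ℂ) * T (i, j) (a, l) + T (i, j) (l, a)
      = (if a = i then ∑ b, T (b, j) (b, l) else 0)
        + (if a = j then ∑ b, T (i, b) (b, l) else 0) := by
    intro i j a l
    have h := Finset.sum_congr rfl fun b (_ : b ∈ Finset.univ) => rel a b i j b l
    simpa [Finset.sum_add_distrib, Finset.sum_ite_irrel] using h
  have hR : ∀ a b j l, (if b = l then ∑ i, T (i, j) (i, a) else 0)
      = if a = j then ∑ i, T (i, b) (i, l) else 0 := by
    intro a b j l
    have h := Finset.sum_congr rfl fun i (_ : i ∈ Finset.univ) => rel a b i j i l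
    simpa [Finset.sum_add_distrib, Finset.sum_ite_irrel] using h
  have hS : ∀ a b i l, (if b = l then ∑ j, T (i, j) (j, a) else 0)
      = if a = i then ∑ j, T (b, j) (j, l) else 0 := by
    intro a b i l
    have h := Finset.sum_congr rfl fun j (_ : j ∈ Finset.univ) => rel a b i j j l
    simp only [Finset.sum_add_distrib, Finset.sum_ite_irrel, Finset.sum_ite_eq, Finset.mem_univ,
      if_true, Finset.sum_const_zero] at h
    rw [add_comm] at h
    exact add_right_cancel h
  let o : Fin N := ⟨0, by omega⟩
  obtain ⟨r, hr⟩ : ∃ r, r = ∑ i, T (i, o) (i, o) := ⟨_, rfl⟩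
  obtain ⟨s, hs⟩ : ∃ s, s = ∑ j, T (o, j) (j, o) := ⟨_, rfl⟩
  have hR' : ∀ j a, ∑ i, T (i, j) (i, a) = if a = j then r else 0 := by
    intro j a
    simpa [hr] using hR a o j o
  have hS' : ∀ i a, ∑ j, T (i, j) (j, a) = if a = i then s else 0 := by
    intro i a
    simpa [hs] using hS a o i o
  have htr : T.trace = N * r := by
    rw [Matrix.trace, Fintype.sum_prod_type_right]
    simp [hR']
  have htrF : (flipOp N * T).trace = N * s := by
    have : (flipOp N * T).trace = ∑ i, ∑ j, T (i, j) (j, i) := by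
      simp [Matrix.trace, Matrix.mul_apply, flipOp, Fintype.sum_prod_type, ite_and]
      exact Finset.sum_comm
    rw [this]
    simp [hS']
  have hN0 : (N : ℂ) ≠ 0 := by exact_mod_cast (by omega : N ≠ 0)
  have hN1 : (N : ℂ) ^ 2 - 1 ≠ 0 := by
    have : N ^ 2 ≠ 1 := by nlinarith
    exact sub_ne_zero.mpr (by exact_mod_cast this)
  rw [htr, htrF]
  ext ⟨i, j⟩ ⟨a, l⟩
  have e1 := h1 i j a l
  have e2 := h1 i j l a
  simp only [hR', hS'] at e1 e2
  simp only [Matrix.add_apply, Matrix.smul_apply, smul_eq_mul, Matrix.one_apply, flipOp,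
    Matrix.of_apply, Prod.mk.injEq]
  rw [mul_div_cancel_left₀ _ hN0, mul_div_cancel_left₀ _ hN0]
  rw [div_mul_eq_mul_div, div_mul_eq_mul_div, ← add_div, eq_div_iff hN1]
  have c1 : (if a = i then (if l = j then r else 0) else 0) = if i = a ∧ j = l then r else 0 := by
    grind
  have c2 : (if a = j then (if l = i then s else 0) else 0) = if i = l ∧ j = a then s else 0 := by
    grind
  have c3 : (if l = i then (if a = j then r else 0) else 0) = if i = l ∧ j = a then r else 0 := by
    grind
  have c4 : (if l = j then (if a = i then s else 0) else 0) = if i = a ∧ j = l then s else 0 := by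
    grind
  rw [c1, c2] at e1
  rw [c3, c4] at e2
  have e : T (i, j) (a, l) * ((N : ℂ) ^ 2 - 1)
      = N * ((if i = a ∧ j = l then r else 0) + if i = l ∧ j = a then s else 0)
        - ((if i = l ∧ j = a then r else 0) + if i = a ∧ j = l then s else 0) := by
    linear_combination (N : ℂ) * e1 - e2
  rw [e]
  split_ifs <;> ring

lemma flipOp_mul_kronecker {N : ℕ} (U V : Matrix (Fin N) (Fin N) ℂ) :
    flipOp N * (U ⊗ₖ V) = (V ⊗ₖ U) * flipOp N := by
  ext ⟨i, j⟩ ⟨k, l⟩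
  simp [Matrix.mul_apply, flipOp, Fintype.sum_prod_type, ite_and, mul_comm]

section Integral

lemma integral_sum_smul {Ω ι E : Type*} [MeasurableSpace Ω] {μ : Measure Ω} [Fintype ι]
    [NormedAddCommGroup E] [NormedSpace ℝ E] [NormedSpace ℂ E]
    [CompleteSpace E] {φ : ι → Ω → ℂ} (hφ : ∀ i, Integrable (φ i) μ) (e : ι → E) {f : Ω → E}
    (hf : ∀ x, f x = ∑ i, φ i x • e i) : ∫ x, f x ∂μ = ∑ i, (∫ x, φ i x ∂μ) • e i := by
  simp only [hf]
  rw [integral_finsetSum _ fun i _ => (hφ i).smul_const _]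
  exact Finset.sum_congr rfl fun i _ => integral_smul_const _ _

variable {N : ℕ}

lemma measurable_unitaryGroup_entry (i j : Fin N) :
    Measurable fun U : Matrix.unitaryGroup (Fin N) ℂ => (U : Matrix (Fin N) (Fin N) ℂ) i j :=
  (measurable_pi_apply j).comp ((measurable_pi_apply i).comp measurable_subtype_coe)

lemma measurable_unitaryGroup_mul_left (V : Matrix.unitaryGroup (Fin N) ℂ) :
    Measurable fun U : Matrix.unitaryGroup (Fin N) ℂ => V * U := by
  refine Measurable.subtype_mk (measurable_pi_lambda _ fun i => measurable_pi_lambda _ fun j => ?_)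
  change Measurable fun U : Matrix.unitaryGroup (Fin N) ℂ =>
    ((V : Matrix (Fin N) (Fin N) ℂ) * (U : Matrix (Fin N) (Fin N) ℂ)) i j
  simp only [Matrix.mul_apply]
  exact Finset.measurable_fun_sum _ fun k _ =>
    (measurable_unitaryGroup_entry k j).const_mul _

/-- Conjugation of `A` by `U ⊗ U`. -/
def kroneckerConj (A : Matrix (Fin N × Fin N) (Fin N × Fin N) ℂ) (U : Matrix (Fin N) (Fin N) ℂ) :
    Matrix (Fin N × Fin N) (Fin N × Fin N) ℂ :=
  (U ⊗ₖ U) * A * (U ⊗ₖ U)ᴴ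

lemma kronecker_mem_unitaryGroup (U : Matrix.unitaryGroup (Fin N) ℂ) :
    ((U : Matrix (Fin N) (Fin N) ℂ) ⊗ₖ (U : Matrix (Fin N) (Fin N) ℂ)) ∈
      Matrix.unitaryGroup (Fin N × Fin N) ℂ :=
  Matrix.kronecker_mem_unitary U.2 U.2

lemma kroneckerConj_mul (A : Matrix (Fin N × Fin N) (Fin N × Fin N) ℂ)
    (V U : Matrix (Fin N) (Fin N) ℂ) :
    kroneckerConj A (V * U) = (V ⊗ₖ V) * kroneckerConj A U * (V ⊗ₖ V)ᴴ := by
  simp only [kroneckerConj, mul_kronecker_mul, conjTranspose_mul, Matrix.mul_assoc]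

lemma trace_kroneckerConj (A : Matrix (Fin N × Fin N) (Fin N × Fin N) ℂ)
    (U : Matrix.unitaryGroup (Fin N) ℂ) : (kroneckerConj A U).trace = A.trace := by
  have h := Matrix.mem_unitaryGroup_iff'.mp (kronecker_mem_unitaryGroup U)
  rw [star_eq_conjTranspose] at h
  rw [kroneckerConj, Matrix.trace_mul_comm, ← Matrix.mul_assoc, h, one_mul]

lemma trace_flipOp_mul_kroneckerConj (A : Matrix (Fin N × Fin N) (Fin N × Fin N) ℂ)
    (U : Matrix.unitaryGroup (Fin N) ℂ) :
    (flipOp N * kroneckerConj A U).trace = (flipOp N * A).trace := by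
  rw [← trace_kroneckerConj (flipOp N * A) U]
  simp only [kroneckerConj, ← Matrix.mul_assoc, flipOp_mul_kronecker]

lemma kroneckerConj_eq_sum_single (A : Matrix (Fin N × Fin N) (Fin N × Fin N) ℂ)
    (U : Matrix (Fin N) (Fin N) ℂ) :
    kroneckerConj A U = ∑ x : (Fin N × Fin N) × (Fin N × Fin N),
      kroneckerConj A U x.1 x.2 • single x.1 x.2 (1 : ℂ) := by
  rw [Fintype.sum_prod_type]
  conv_lhs => rw [matrix_eq_sum_single (kroneckerConj A U)]
  simp

variable (μH : Measure (Matrix.unitaryGroup (Fin N) ℂ)) [IsProbabilityMeasure μH]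

lemma integrable_kroneckerConj_entry (A : Matrix (Fin N × Fin N) (Fin N × Fin N) ℂ)
    (x : (Fin N × Fin N) × (Fin N × Fin N)) :
    Integrable (fun U : Matrix.unitaryGroup (Fin N) ℂ =>
      kroneckerConj A (U : Matrix (Fin N) (Fin N) ℂ) x.1 x.2) μH := by
  simp only [kroneckerConj, Matrix.mul_apply, conjTranspose_apply, kroneckerMap_apply,
    Finset.sum_mul]
  refine integrable_finsetSum _ fun s _ => integrable_finsetSum _ fun t _ => ?_
  have hm := measurable_unitaryGroup_entry (N := N)
  refine Integrable.of_bound (C := 1 * 1 * ‖A t s‖ * (1 * 1)) ?_ (ae_of_all _ fun U => ?_)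
  · exact ((((hm _ _).mul (hm _ _)).mul_const _).mul
      (continuous_star.measurable.comp ((hm _ _).mul (hm _ _)))).aestronglyMeasurable
  · simp only [norm_mul, norm_star]
    gcongr <;> exact entry_norm_bound_of_unitary U.2 _ _

lemma map_integral_kroneckerConj {F : Type*} [NormedAddCommGroup F] [NormedSpace ℝ F]
    [NormedSpace ℂ F] [CompleteSpace F]
    (A : Matrix (Fin N × Fin N) (Fin N × Fin N) ℂ)
    (L : Matrix (Fin N × Fin N) (Fin N × Fin N) ℂ →ₗ[ℂ] F) :
    L (∫ U : Matrix.unitaryGroup (Fin N) ℂ, kroneckerConj A (U : Matrix (Fin N) (Fin N) ℂ) ∂μH)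
      = ∫ U : Matrix.unitaryGroup (Fin N) ℂ,
        L (kroneckerConj A (U : Matrix (Fin N) (Fin N) ℂ)) ∂μH := by
  have hint := integrable_kroneckerConj_entry μH A
  rw [integral_sum_smul hint _ fun U => kroneckerConj_eq_sum_single A _,
    integral_sum_smul hint (fun x => L (single x.1 x.2 1)), map_sum]
  · simp only [map_smul]
  · intro U
    conv_lhs => rw [kroneckerConj_eq_sum_single A U]
    simp only [map_sum, map_smul]

lemma integral_kroneckerConj_mul_left [μH.IsMulLeftInvariant]
    (A : Matrix (Fin N × Fin N) (Fin N × Fin N) ℂ) (V : Matrix.unitaryGroup (Fin N) ℂ) :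
    ∫ U : Matrix.unitaryGroup (Fin N) ℂ, kroneckerConj A
        ((V : Matrix (Fin N) (Fin N) ℂ) * (U : Matrix (Fin N) (Fin N) ℂ)) ∂μH
      = ∫ U : Matrix.unitaryGroup (Fin N) ℂ, kroneckerConj A (U : Matrix (Fin N) (Fin N) ℂ) ∂μH := by
  have hint := integrable_kroneckerConj_entry μH A
  have hpres : MeasurePreserving (fun U => V * U) μH μH :=
    ⟨measurable_unitaryGroup_mul_left V, Measure.IsMulLeftInvariant.map_mul_left_eq_self V⟩
  rw [integral_sum_smul hint _ fun U => kroneckerConj_eq_sum_single A _]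
  refine (integral_sum_smul (fun x => hpres.integrable_comp_of_integrable (hint x)) _
    fun U => kroneckerConj_eq_sum_single A _).trans ?_
  refine Finset.sum_congr rfl fun x _ => ?_
  congr 1
  have hx := (hint x).aestronglyMeasurable
  rw [← hpres.map_eq] at hx
  have h := integral_map hpres.measurable.aemeasurable hx
  rw [hpres.map_eq] at h
  exact h.symm

lemma commute_integral_kroneckerConj [μH.IsMulLeftInvariant]
    (A : Matrix (Fin N × Fin N) (Fin N × Fin N) ℂ)
    (V : Matrix (Fin N) (Fin N) ℂ) (hV : V ∈ Matrix.unitaryGroup (Fin N) ℂ) :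
    Commute (∫ U : Matrix.unitaryGroup (Fin N) ℂ,
      kroneckerConj A (U : Matrix (Fin N) (Fin N) ℂ) ∂μH) (V ⊗ₖ V) := by
  have hmap := map_integral_kroneckerConj μH A
    (LinearMap.mulRight ℂ (V ⊗ₖ V)ᴴ ∘ₗ LinearMap.mulLeft ℂ (V ⊗ₖ V))
  have hinv := integral_kroneckerConj_mul_left μH A ⟨V, hV⟩
  simp only [kroneckerConj_mul] at hinv
  simp only [LinearMap.comp_apply, LinearMap.mulRight_apply, LinearMap.mulLeft_apply] at hmap
  rw [hinv] at hmap
  have hVV := Matrix.mem_unitaryGroup_iff'.mp (kronecker_mem_unitaryGroup ⟨V, hV⟩)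
  rw [star_eq_conjTranspose] at hVV
  rw [Commute, SemiconjBy]
  conv_lhs => rw [← hmap]
  rw [Matrix.mul_assoc, hVV, mul_one]

end Integral

/-- For `N ≥ 2` and every `A ∈ M_{N²}(ℂ)`, the second moment of conjugation by
a Haar-random unitary satisfies
`∫ (U ⊗ U) A (U ⊗ U)† dμ_H(U) = c_I • I + c_F • 𝔽`, where
`c_I = (tr(A) − tr(𝔽A)/N)/(N² − 1)` and `c_F = (tr(𝔽A) − tr(A)/N)/(N² − 1)`. -/
theorem second_moment_haar_unitary (N : ℕ) (hN : 2 ≤ N)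
    (A : Matrix (Fin N × Fin N) (Fin N × Fin N) ℂ)
    (μH : Measure (Matrix.unitaryGroup (Fin N) ℂ))
    [IsProbabilityMeasure μH] [μH.IsMulLeftInvariant] [μH.IsMulRightInvariant] :
    (∫ U : Matrix.unitaryGroup (Fin N) ℂ,
        ((U : Matrix (Fin N) (Fin N) ℂ) ⊗ₖ (U : Matrix (Fin N) (Fin N) ℂ)) * A *
          ((U : Matrix (Fin N) (Fin N) ℂ) ⊗ₖ (U : Matrix (Fin N) (Fin N) ℂ))ᴴ ∂μH)
      = ((A.trace - (flipOp N * A).trace / (N : ℂ)) / ((N : ℂ) ^ 2 - 1)) •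
          (1 : Matrix (Fin N × Fin N) (Fin N × Fin N) ℂ)
        + (((flipOp N * A).trace - A.trace / (N : ℂ)) / ((N : ℂ) ^ 2 - 1)) • flipOp N := by
  have h := eq_smul_one_add_smul_flipOp_of_commute hN (commute_integral_kroneckerConj μH A)
  have htr := map_integral_kroneckerConj μH A (traceLinearMap (Fin N × Fin N) ℂ ℂ)
  have htrF := map_integral_kroneckerConj μH A
    (traceLinearMap (Fin N × Fin N) ℂ ℂ ∘ₗ LinearMap.mulLeft ℂ (flipOp N))
  simp only [LinearMap.comp_apply, traceLinearMap_apply, LinearMap.mulLeft_apply,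
    trace_kroneckerConj, trace_flipOp_mul_kroneckerConj, integral_const, probReal_univ,
    one_smul] at htr htrF
  rw [htr, htrF] at h
  exact h

end
end

section
/- Let N ≥ 2, let ρ be a density matrix on ℂ^N, and let O be an N×N complex Hermitian matrix. Then the second moment of the expectation value under a Haar-random unitary satisfies ∫_{U(N)} (tr(O U ρ U†))² dμ_H(U) = ((N − tr(ρ²))/(N(N² − 1))) · tr(O)² + ((N·tr(ρ²) − 1)/(N(N² − 1))) · tr(O²). -/
open MeasureTheory Matrix
open scoped ComplexOrder

attribute [local instance] Matrix.frobeniusNormedAddCommGroup Matrix.frobeniusNormedSpace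

noncomputable section

namespace UnitaryMoment

variable {n : Type*} [Fintype n] [DecidableEq n]

lemma measurable_coe_apply (i j : n) : Measurable fun U : unitaryGroup n ℂ => U.1 i j :=
  (measurable_pi_apply j).comp ((measurable_pi_apply i).comp measurable_subtype_coe)

instance : MeasurableMul (unitaryGroup n ℂ) where
  measurable_const_mul c := by
    refine Measurable.subtype_mk (measurable_pi_lambda _ fun i => measurable_pi_lambda _ fun j => ?_)
    simp only [Matrix.mul_apply]
    exact Finset.measurable_sum _ fun k _ => (measurable_coe_apply k j).const_mul _
  measurable_mul_const c := by
    refine Measurable.subtype_mk (measurable_pi_lambda _ fun i => measurable_pi_lambda _ fun j => ?_)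
    simp only [Matrix.mul_apply]
    exact Finset.measurable_sum _ fun k _ => (measurable_coe_apply i k).mul_const _

/-- The squared modulus of the `(i, j)` entry of a unitary matrix. -/
def weight (i j : n) (U : unitaryGroup n ℂ) : ℝ := Complex.normSq (U.1 i j)

lemma measurable_weight (i j : n) : Measurable (weight i j) :=
  Complex.continuous_normSq.measurable.comp (measurable_coe_apply i j)

lemma weight_nonneg (i j : n) (U : unitaryGroup n ℂ) : 0 ≤ weight i j U :=
  Complex.normSq_nonneg _

lemma sum_weight_row (i : n) (U : unitaryGroup n ℂ) : ∑ j, weight i j U = 1 := by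
  have h := congrFun (congrFun (mem_unitaryGroup_iff.1 U.2) i) i
  rw [Matrix.mul_apply, Matrix.one_apply_eq] at h
  have h' : ((∑ j, weight i j U : ℝ) : ℂ) = 1 := by
    rw [← h]
    push_cast
    refine Finset.sum_congr rfl fun j _ => ?_
    simp [weight, Matrix.star_apply, Complex.mul_conj]
  exact_mod_cast h'

lemma sum_weight_col (j : n) (U : unitaryGroup n ℂ) : ∑ i, weight i j U = 1 := by
  have h := congrFun (congrFun (mem_unitaryGroup_iff'.1 U.2) j) j
  rw [Matrix.mul_apply, Matrix.one_apply_eq] at h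
  have h' : ((∑ i, weight i j U : ℝ) : ℂ) = 1 := by
    rw [← h]
    push_cast
    refine Finset.sum_congr rfl fun i _ => ?_
    simp [weight, Matrix.star_apply, mul_comm, Complex.mul_conj]
  exact_mod_cast h'

lemma weight_le_one (i j : n) (U : unitaryGroup n ℂ) : weight i j U ≤ 1 := by
  rw [← sum_weight_row i U]
  exact Finset.single_le_sum (fun k _ => weight_nonneg i k U) (Finset.mem_univ j)

/-- The unitary matrix of a permutation. -/
def permUnitary (σ : Equiv.Perm n) : unitaryGroup n ℂ :=
  ⟨(1 : Matrix n n ℂ).submatrix id σ, by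
    rw [mem_unitaryGroup_iff, star_eq_conjTranspose, conjTranspose_submatrix, conjTranspose_one,
      submatrix_mul_equiv, Matrix.one_mul, submatrix_id_id]⟩

lemma mul_permUnitary_apply (U : unitaryGroup n ℂ) (σ : Equiv.Perm n) (i j : n) :
    (U * permUnitary σ).1 i j = U.1 i (σ j) := by
  simp [permUnitary, Matrix.mul_apply, Matrix.one_apply]

lemma permUnitary_mul_apply (U : unitaryGroup n ℂ) (σ : Equiv.Perm n) (i j : n) :
    (permUnitary σ * U).1 (σ i) j = U.1 i j := by
  simp [permUnitary, Matrix.mul_apply, Matrix.one_apply]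

/-- The Hermitian unitary acting as the `2 × 2` Hadamard matrix on the coordinates `p, q`. -/
def hadamard {p q : n} (h : p ≠ q) : unitaryGroup n ℂ :=
  ⟨1 + single p p (((√2)⁻¹ : ℝ) - 1 : ℂ) + single p q (((√2)⁻¹ : ℝ) : ℂ)
    + single q p (((√2)⁻¹ : ℝ) : ℂ) + single q q (-((√2)⁻¹ : ℝ) - 1 : ℂ), by
    have hc : (((√2)⁻¹ : ℝ) : ℂ) * (((√2)⁻¹ : ℝ) : ℂ) = 1 / 2 := by
      rw [← Complex.ofReal_mul, ← mul_inv, Real.mul_self_sqrt (by norm_num)]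
      norm_num
    rw [mem_unitaryGroup_iff, star_eq_conjTranspose]
    simp only [conjTranspose_add, conjTranspose_one, conjTranspose_single, star_sub, star_neg,
      star_one, Complex.star_def, Complex.conj_ofReal]
    generalize (((√2)⁻¹ : ℝ) : ℂ) = c at hc
    have hpq (i j : n) (a b : ℂ) : single i p a * single q j b = 0 := by simp [h]
    have hqp (i j : n) (a b : ℂ) : single i q a * single p j b = 0 := by simp [h.symm]
    simp only [Matrix.add_mul, Matrix.mul_add, Matrix.one_mul, Matrix.mul_one,
      single_mul_single_same, hpq, hqp]
    ext i j
    simp only [Matrix.add_apply, single_apply, Matrix.zero_apply]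
    split_ifs <;> first | (exfalso; grind) | linear_combination 2 * hc | ring1⟩

lemma mul_hadamard_apply_left (U : unitaryGroup n ℂ) {p q : n} (h : p ≠ q) (i : n) :
    (U * hadamard h).1 i p = (((√2)⁻¹ : ℝ) : ℂ) * (U.1 i p + U.1 i q) := by
  simp [hadamard, Matrix.mul_add, h]
  ring

lemma mul_hadamard_apply_right (U : unitaryGroup n ℂ) {p q : n} (h : p ≠ q) (i : n) :
    (U * hadamard h).1 i q = (((√2)⁻¹ : ℝ) : ℂ) * (U.1 i p - U.1 i q) := by
  simp [hadamard, Matrix.mul_add, h.symm]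
  ring

/-- The diagonal unitary multiplying the coordinate `q` by `I`. -/
def phase (q : n) : unitaryGroup n ℂ :=
  ⟨diagonal (Function.update 1 q Complex.I), by
    rw [mem_unitaryGroup_iff, star_eq_conjTranspose, diagonal_conjTranspose, diagonal_mul_diagonal,
      ← diagonal_one]
    congr 1
    ext i
    by_cases hi : i = q
    · subst hi; simp
    · simp [hi]⟩

lemma mul_phase_apply_self (U : unitaryGroup n ℂ) (q i : n) :
    (U * phase q).1 i q = U.1 i q * Complex.I := by
  simp [phase]

lemma mul_phase_apply_of_ne (U : unitaryGroup n ℂ) {p q : n} (h : p ≠ q) (i : n) :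
    (U * phase q).1 i p = U.1 i p := by
  simp [phase, h]

lemma weight_mul_hadamard (U : unitaryGroup n ℂ) {p q : n} (h : p ≠ q) (i : n) :
    4 * (weight i p (U * hadamard h) * weight i q (U * hadamard h)
      + weight i p (U * phase q * hadamard h) * weight i q (U * phase q * hadamard h))
    = 2 * (weight i p U * weight i p U + weight i q U * weight i q U) := by
  have hc : (√2)⁻¹ * (√2)⁻¹ = (1 / 2 : ℝ) := by
    rw [← mul_inv, Real.mul_self_sqrt (by norm_num)]
    norm_num
  simp only [weight, mul_hadamard_apply_left, mul_hadamard_apply_right, mul_phase_apply_self,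
    mul_phase_apply_of_ne U h, Complex.normSq_mul, Complex.normSq_ofReal, hc]
  simp only [Complex.normSq_apply, Complex.add_re, Complex.add_im, Complex.sub_re, Complex.sub_im,
    Complex.mul_re, Complex.mul_im, Complex.I_re, Complex.I_im]
  ring

section Moments

variable (μ : Measure (unitaryGroup n ℂ))

/-- The mixed second moment of the squared moduli of two entries. -/
def moment (i j k l : n) : ℝ := ∫ U, weight i j U * weight k l U ∂μ

lemma moment_perm_row [μ.IsMulLeftInvariant] (σ : Equiv.Perm n) (i j k l : n) :
    moment μ (σ i) j (σ k) l = moment μ i j k l := by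
  rw [moment, ← integral_mul_left_eq_self _ (permUnitary σ)]
  simp only [weight, permUnitary_mul_apply, moment]

lemma moment_perm_col [μ.IsMulRightInvariant] (σ : Equiv.Perm n) (i j k l : n) :
    moment μ i (σ j) k (σ l) = moment μ i j k l := by
  conv_rhs => rw [moment, ← integral_mul_right_eq_self _ (permUnitary σ)]
  simp only [weight, mul_permUnitary_apply, moment]

variable [IsProbabilityMeasure μ]

lemma integrable_weight (i j : n) : Integrable (weight i j) μ :=
  Integrable.of_bound (measurable_weight i j).aestronglyMeasurable 1 <| .of_forall fun U => by
    rw [Real.norm_of_nonneg (weight_nonneg i j U)]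
    exact weight_le_one i j U

lemma integrable_weight_mul_weight (i j k l : n) :
    Integrable (fun U => weight i j U * weight k l U) μ :=
  Integrable.of_bound ((measurable_weight i j).mul (measurable_weight k l)).aestronglyMeasurable 1 <|
    .of_forall fun U => by
      rw [Real.norm_of_nonneg (mul_nonneg (weight_nonneg i j U) (weight_nonneg k l U))]
      exact mul_le_one₀ (weight_le_one i j U) (weight_nonneg k l U) (weight_le_one k l U)

lemma sum_moment_row (i j k : n) : ∑ l, moment μ i j k l = ∫ U, weight i j U ∂μ := by
  simp only [moment]
  rw [← integral_finsetSum _ fun l _ => integrable_weight_mul_weight μ i j k l]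
  simp [← Finset.mul_sum, sum_weight_row]

lemma sum_moment_col (i j l : n) : ∑ k, moment μ i j k l = ∫ U, weight i j U ∂μ := by
  simp only [moment]
  rw [← integral_finsetSum _ fun k _ => integrable_weight_mul_weight μ i j k l]
  simp [← Finset.mul_sum, sum_weight_col]

lemma integral_weight [μ.IsMulRightInvariant] (i j : n) :
    ∫ U, weight i j U ∂μ = 1 / Fintype.card n := by
  have h (l : n) : ∫ U, weight i l U ∂μ = ∫ U, weight i j U ∂μ := by
    conv_rhs => rw [← integral_mul_right_eq_self _ (permUnitary (Equiv.swap j l))]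
    simp only [weight, mul_permUnitary_apply, Equiv.swap_apply_left]
  have hs : ∑ l, ∫ U, weight i l U ∂μ = 1 := by
    rw [← integral_finsetSum _ fun l _ => integrable_weight μ i l]
    simp [sum_weight_row]
  simp only [h, Finset.sum_const, Finset.card_univ, nsmul_eq_mul] at hs
  have : Nonempty n := ⟨i⟩
  rw [eq_div_iff (by simp), mul_comm, hs]

lemma two_mul_moment_same_row [μ.IsMulRightInvariant] {p q : n} (h : p ≠ q) (i : n) :
    2 * moment μ i p i q = moment μ i p i p := by
  have hq : moment μ i q i q = moment μ i p i p := by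
    simpa using moment_perm_col μ (Equiv.swap p q) i p i p
  have h₁ : moment μ i p i q = ∫ U, weight i p (U * hadamard h) * weight i q (U * hadamard h) ∂μ :=
    (integral_mul_right_eq_self (fun U => weight i p U * weight i q U) (hadamard h)).symm
  have h₂ : moment μ i p i q = ∫ U, weight i p (U * phase q * hadamard h)
      * weight i q (U * phase q * hadamard h) ∂μ := by
    simp only [mul_assoc]
    exact (integral_mul_right_eq_self (fun U => weight i p U * weight i q U)
      (phase q * hadamard h)).symm
  have i₁ := (integrable_weight_mul_weight μ i p i q).comp_mul_right (hadamard h)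
  have i₂ := (integrable_weight_mul_weight μ i p i q).comp_mul_right (phase q * hadamard h)
  simp only [← mul_assoc] at i₂
  have key := integral_congr_ae (μ := μ) (.of_forall fun U => weight_mul_hadamard U h i)
  rw [integral_const_mul, integral_const_mul, integral_add i₁ i₂,
    integral_add (integrable_weight_mul_weight μ i p i p) (integrable_weight_mul_weight μ i q i q),
    ← h₁, ← h₂] at key
  change _ = 2 * (moment μ i p i p + moment μ i q i q) at key
  linarith

lemma moment_same_row [μ.IsMulRightInvariant] {p q : n} (h : p ≠ q) (i : n) :
    moment μ i p i q = 1 / (Fintype.card n * (Fintype.card n + 1)) := by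
  have hs := sum_moment_row μ i p i
  have hc : 0 < Fintype.card n := Fintype.card_pos_iff.2 ⟨i⟩
  have hc' : (0 : ℝ) < Fintype.card n := by exact_mod_cast hc
  have he : ∀ l ∈ Finset.univ.erase p, moment μ i p i l = moment μ i p i q := fun l hl => by
    have := two_mul_moment_same_row μ (Finset.ne_of_mem_erase hl).symm i
    linarith [two_mul_moment_same_row μ h i]
  rw [← Finset.add_sum_erase _ _ (Finset.mem_univ p), Finset.sum_congr rfl he, Finset.sum_const,
    Finset.card_erase_of_mem (Finset.mem_univ p), Finset.card_univ, nsmul_eq_mul, Nat.cast_pred hc,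
    integral_weight, ← two_mul_moment_same_row μ h i] at hs
  field_simp at hs ⊢
  linarith

lemma moment_self [μ.IsMulRightInvariant] (hn : 2 ≤ Fintype.card n) (i j : n) :
    moment μ i j i j = 2 / (Fintype.card n * (Fintype.card n + 1)) := by
  have : Nontrivial n := Fintype.one_lt_card_iff_nontrivial.1 hn
  obtain ⟨q, hq⟩ := exists_ne j
  rw [← two_mul_moment_same_row μ hq.symm, moment_same_row μ hq.symm]
  ring

lemma moment_same_col [μ.IsMulLeftInvariant] [μ.IsMulRightInvariant] {i k : n} (h : i ≠ k) (j : n) :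
    moment μ i j k j = 1 / (Fintype.card n * (Fintype.card n + 1)) := by
  have hs := sum_moment_col μ i j j
  have hn : 2 ≤ Fintype.card n := Fintype.one_lt_card_iff_nontrivial.2 ⟨i, k, h⟩
  have hc : (2 : ℝ) ≤ Fintype.card n := by exact_mod_cast hn
  have he : ∀ l ∈ Finset.univ.erase i, moment μ i j l j = moment μ i j k j := fun l hl => by
    have := moment_perm_row μ (Equiv.swap k l) i j k j
    rwa [Equiv.swap_apply_left,
      Equiv.swap_apply_of_ne_of_ne h (Finset.ne_of_mem_erase hl).symm] at this
  rw [← Finset.add_sum_erase _ _ (Finset.mem_univ i), Finset.sum_congr rfl he, Finset.sum_const,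
    Finset.card_erase_of_mem (Finset.mem_univ i), Finset.card_univ, nsmul_eq_mul,
    Nat.cast_pred (by omega), integral_weight, moment_self μ hn] at hs
  have h₁ : (Fintype.card n : ℝ) - 1 ≠ 0 := by linarith
  refine mul_left_cancel₀ h₁ ?_
  rw [← eq_sub_iff_add_eq'] at hs
  rw [hs]
  field_simp
  ring

lemma moment_of_ne [μ.IsMulLeftInvariant] [μ.IsMulRightInvariant] {i k j l : n} (h : i ≠ k)
    (h' : j ≠ l) : moment μ i j k l = 1 / ((Fintype.card n : ℝ) ^ 2 - 1) := by
  have hs := sum_moment_row μ i j k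
  have hn : 2 ≤ Fintype.card n := Fintype.one_lt_card_iff_nontrivial.2 ⟨i, k, h⟩
  have hc : (2 : ℝ) ≤ Fintype.card n := by exact_mod_cast hn
  have he : ∀ m ∈ Finset.univ.erase j, moment μ i j k m = moment μ i j k l := fun m hm => by
    have := moment_perm_col μ (Equiv.swap l m) i j k l
    rwa [Equiv.swap_apply_left,
      Equiv.swap_apply_of_ne_of_ne h' (Finset.ne_of_mem_erase hm).symm] at this
  rw [← Finset.add_sum_erase _ _ (Finset.mem_univ j), Finset.sum_congr rfl he, Finset.sum_const,
    Finset.card_erase_of_mem (Finset.mem_univ j), Finset.card_univ, nsmul_eq_mul,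
    Nat.cast_pred (by omega), integral_weight, moment_same_col μ h] at hs
  have h₁ : (Fintype.card n : ℝ) - 1 ≠ 0 := by linarith
  have h₂ : (Fintype.card n : ℝ) ^ 2 - 1 ≠ 0 := by nlinarith
  refine mul_left_cancel₀ h₁ ?_
  rw [← eq_sub_iff_add_eq'] at hs
  rw [hs]
  field_simp
  ring

lemma moment_eq [μ.IsMulLeftInvariant] [μ.IsMulRightInvariant] (hn : 2 ≤ Fintype.card n)
    (i j k l : n) :
    moment μ i j k l = 1 / ((Fintype.card n : ℝ) * ((Fintype.card n : ℝ) ^ 2 - 1)) *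
      (Fintype.card n * (1 + (if i = k then 1 else 0) * (if j = l then 1 else 0))
        - ((if i = k then 1 else 0) + (if j = l then 1 else 0))) := by
  have hc : (2 : ℝ) ≤ Fintype.card n := by exact_mod_cast hn
  have h₂ : (Fintype.card n : ℝ) ^ 2 - 1 ≠ 0 := by nlinarith
  by_cases h : i = k <;> by_cases h' : j = l
  · subst h h'
    simp only [moment_self μ hn, if_true]
    field_simp
    ring
  · subst h
    simp only [moment_same_row μ h', h', if_true, if_false]
    field_simp
    ring
  · subst h'
    simp only [moment_same_col μ h, h, if_true, if_false]
    field_simp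
    ring
  · simp only [moment_of_ne μ h h', h, h', if_false]
    field_simp
    ring

lemma integral_sq_sum_weight [μ.IsMulLeftInvariant] [μ.IsMulRightInvariant]
    (hn : 2 ≤ Fintype.card n) (d p : n → ℝ) :
    ∫ U, (∑ i, ∑ j, d i * p j * weight i j U) ^ 2 ∂μ
      = 1 / ((Fintype.card n : ℝ) * ((Fintype.card n : ℝ) ^ 2 - 1)) *
        ((Fintype.card n * (∑ j, p j) ^ 2 - ∑ j, p j * p j) * (∑ i, d i) ^ 2
          + (Fintype.card n * (∑ j, p j * p j) - (∑ j, p j) ^ 2) * ∑ i, d i * d i) := by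
  have h (U : unitaryGroup n ℂ) : (∑ i, ∑ j, d i * p j * weight i j U) ^ 2
      = ∑ i, ∑ k, ∑ j, ∑ l, d i * d k * (p j * p l) * (weight i j U * weight k l U) := by
    rw [sq, Finset.sum_mul_sum]
    refine Finset.sum_congr rfl fun i _ => Finset.sum_congr rfl fun k _ => ?_
    rw [Finset.sum_mul_sum]
    exact Finset.sum_congr rfl fun j _ => Finset.sum_congr rfl fun l _ => by ring
  have hi (i k j l : n) := (integrable_weight_mul_weight μ i j k l).const_mul
    (d i * d k * (p j * p l))
  simp only [h]
  rw [integral_finsetSum _ fun i _ => integrable_finsetSum _ fun k _ =>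
    integrable_finsetSum _ fun j _ => integrable_finsetSum _ fun l _ => hi i k j l]
  have hm (i k : n) : ∫ U, ∑ j, ∑ l, d i * d k * (p j * p l) * (weight i j U * weight k l U) ∂μ
      = ∑ j, ∑ l, d i * d k * (p j * p l) * moment μ i j k l := by
    rw [integral_finsetSum _ fun j _ => integrable_finsetSum _ fun l _ => hi i k j l]
    refine Finset.sum_congr rfl fun j _ => ?_
    rw [integral_finsetSum _ fun l _ => hi i k j l]
    exact Finset.sum_congr rfl fun l _ => integral_const_mul _ _
  have hs (i : n) := integral_finsetSum (μ := μ) Finset.univ fun k _ =>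
    integrable_finsetSum Finset.univ fun j _ => integrable_finsetSum Finset.univ
      fun l _ => hi i k j l
  simp only [hs, hm, moment_eq μ hn]
  generalize (Fintype.card n : ℝ) = N
  generalize 1 / (N * (N ^ 2 - 1)) = c
  have hin (i k : n) : ∑ j, ∑ l, d i * d k * (p j * p l) *
      (c * (N * (1 + (if i = k then 1 else 0) * (if j = l then 1 else 0))
        - ((if i = k then 1 else 0) + (if j = l then 1 else 0))))
      = d i * d k * c * (N * (∑ j, p j) ^ 2 - ∑ j, p j * p j)
        + (if i = k then d i * d k * c * (N * (∑ j, p j * p j) - (∑ j, p j) ^ 2) else 0) := by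
    have e₁ : (∑ j, p j) ^ 2 = ∑ j, ∑ l, p j * p l := by rw [sq, Finset.sum_mul_sum]
    have e₂ : ∑ j, p j * p j = ∑ j, ∑ l, if j = l then p j * p l else 0 := by simp
    rw [e₁, e₂]
    split_ifs with hik
    · simp only [Finset.mul_sum, ← Finset.sum_sub_distrib, ← Finset.sum_add_distrib]
      refine Finset.sum_congr rfl fun j _ => Finset.sum_congr rfl fun l _ => ?_
      split_ifs <;> ring
    · simp only [Finset.mul_sum, ← Finset.sum_sub_distrib, add_zero]
      refine Finset.sum_congr rfl fun j _ => Finset.sum_congr rfl fun l _ => ?_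
      split_ifs <;> ring
  simp only [hin, Finset.sum_add_distrib, Finset.sum_ite_eq, Finset.mem_univ, if_true,
    ← Finset.sum_mul]
  rw [← Finset.sum_mul_sum]
  ring

end Moments

lemma trace_diagonal_mul_conj (d p : n → ℝ) (U : unitaryGroup n ℂ) :
    (diagonal (fun i => (d i : ℂ)) * U.1 * diagonal (fun i => (p i : ℂ)) * U.1ᴴ).trace
      = ((∑ i, ∑ j, d i * p j * weight i j U : ℝ) : ℂ) := by
  simp only [Matrix.trace, Matrix.diag_apply]
  push_cast
  refine Finset.sum_congr rfl fun i _ => ?_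
  rw [Matrix.mul_apply]
  refine Finset.sum_congr rfl fun j _ => ?_
  rw [mul_diagonal, diagonal_mul, conjTranspose_apply, weight, ← Complex.mul_conj,
    Complex.star_def]
  ring

/-- A Hermitian matrix is unitarily conjugate to a real diagonal matrix. -/
lemma exists_eq_conj_diagonal {A : Matrix n n ℂ} (hA : A.IsHermitian) :
    ∃ (V : unitaryGroup n ℂ) (d : n → ℝ),
      A = V.1 * diagonal (fun i => (d i : ℂ)) * V.1ᴴ := by
  refine ⟨hA.eigenvectorUnitary, hA.eigenvalues, ?_⟩
  conv_lhs => rw [hA.spectral_theorem]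
  rfl

lemma conjTranspose_coe_mul (V : unitaryGroup n ℂ) : V.1ᴴ * V.1 = 1 :=
  UnitaryGroup.star_mul_self V

lemma trace_conj (V : unitaryGroup n ℂ) (A : Matrix n n ℂ) :
    (V.1 * A * V.1ᴴ).trace = A.trace := by
  rw [Matrix.trace_mul_comm, ← Matrix.mul_assoc, conjTranspose_coe_mul, Matrix.one_mul]

lemma trace_conj_mul_conj (V : unitaryGroup n ℂ) (A : Matrix n n ℂ) :
    (V.1 * A * V.1ᴴ * (V.1 * A * V.1ᴴ)).trace = (A * A).trace := by
  rw [← trace_conj V (A * A)]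
  congr 1
  calc _ = V.1 * A * (V.1ᴴ * V.1) * A * V.1ᴴ := by simp only [Matrix.mul_assoc]
    _ = _ := by rw [conjTranspose_coe_mul, Matrix.mul_one, Matrix.mul_assoc V.1]

lemma trace_diagonal_ofReal (d : n → ℝ) :
    (diagonal (fun i => (d i : ℂ))).trace = ((∑ i, d i : ℝ) : ℂ) := by
  simp [Matrix.trace_diagonal]

lemma trace_diagonal_mul_self (d : n → ℝ) :
    (diagonal (fun i => (d i : ℂ)) * diagonal (fun i => (d i : ℂ))).trace
      = ((∑ i, d i * d i : ℝ) : ℂ) := by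
  simp [Matrix.trace_diagonal]

/-- The second moment of `tr (O U A U†)` for Hermitian `O` and `A` under a bi-invariant
probability measure. -/
lemma integral_trace_sq (μ : Measure (unitaryGroup n ℂ)) [IsProbabilityMeasure μ]
    [μ.IsMulLeftInvariant] [μ.IsMulRightInvariant] (hn : 2 ≤ Fintype.card n)
    {O A : Matrix n n ℂ} (hO : O.IsHermitian) (hA : A.IsHermitian) :
    ∫ U : unitaryGroup n ℂ, (O * U.1 * A * U.1ᴴ).trace ^ 2 ∂μ
      = 1 / ((Fintype.card n : ℂ) * ((Fintype.card n : ℂ) ^ 2 - 1)) *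
        ((Fintype.card n * A.trace ^ 2 - (A * A).trace) * O.trace ^ 2
          + (Fintype.card n * (A * A).trace - A.trace ^ 2) * (O * O).trace) := by
  obtain ⟨V, d, rfl⟩ := exists_eq_conj_diagonal hO
  obtain ⟨W, p, rfl⟩ := exists_eq_conj_diagonal hA
  set f : unitaryGroup n ℂ → ℂ := fun U =>
    ((∑ i, ∑ j, d i * p j * weight i j U : ℝ) : ℂ) ^ 2 with hf
  have h (U : unitaryGroup n ℂ) :
      (V.1 * diagonal (fun i => (d i : ℂ)) * V.1ᴴ * U.1 *
        (W.1 * diagonal (fun i => (p i : ℂ)) * W.1ᴴ) * U.1ᴴ).trace ^ 2 = f (V⁻¹ * U * W) := by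
    simp only [hf]
    rw [← trace_diagonal_mul_conj]
    congr 1
    simp only [UnitaryGroup.mul_val, UnitaryGroup.inv_val, star_eq_conjTranspose,
      conjTranspose_mul, conjTranspose_conjTranspose]
    simp only [Matrix.mul_assoc]
    rw [Matrix.trace_mul_comm]
    simp only [Matrix.mul_assoc]
  simp only [h, trace_conj, trace_conj_mul_conj, trace_diagonal_ofReal, trace_diagonal_mul_self]
  rw [integral_mul_left_eq_self (fun U => f (U * W)) V⁻¹, integral_mul_right_eq_self f W]
  simp only [hf, ← Complex.ofReal_pow]
  rw [integral_complex_ofReal, integral_sq_sum_weight μ hn]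
  push_cast
  ring

end UnitaryMoment

/-- For `N ≥ 2`, a density matrix `ρ` on `ℂ^N` and a Hermitian `O ∈ M_N(ℂ)`,
`∫ (tr(O U ρ U†))² dμ_H(U)
  = ((N − tr(ρ²))/(N(N² − 1))) tr(O)² + ((N tr(ρ²) − 1)/(N(N² − 1))) tr(O²)`. -/
theorem second_moment_expectation_value_haar (N : ℕ) (hN : 2 ≤ N)
    (ρ O : Matrix (Fin N) (Fin N) ℂ)
    (hρ : ρ.PosSemidef) (hρtr : ρ.trace = 1) (hO : O.IsHermitian)
    (μH : Measure (Matrix.unitaryGroup (Fin N) ℂ))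
    [IsProbabilityMeasure μH] [μH.IsMulLeftInvariant] [μH.IsMulRightInvariant] :
    (∫ U : Matrix.unitaryGroup (Fin N) ℂ,
        (Matrix.trace (O * (U : Matrix (Fin N) (Fin N) ℂ) * ρ *
          (U : Matrix (Fin N) (Fin N) ℂ)ᴴ)) ^ 2 ∂μH)
      = (((N : ℂ) - (ρ * ρ).trace) / ((N : ℂ) * ((N : ℂ) ^ 2 - 1))) * O.trace ^ 2
        + (((N : ℂ) * (ρ * ρ).trace - 1) / ((N : ℂ) * ((N : ℂ) ^ 2 - 1))) * (O * O).trace := by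
  have h := UnitaryMoment.integral_trace_sq μH (by simpa using hN) hO hρ.isHermitian
  rw [Fintype.card_fin, hρtr] at h
  rw [h]
  ring

end
end

section
/- Let N ≥ 2 and let ν be a Borel probability measure on U(N) that is an exact unitary 2-design, i.e. ∫ U A U† dν(U) = ∫ U A U† dμ_H(U) for every A ∈ M_N(ℂ) and ∫ (U ⊗ U) B (U ⊗ U)† dν(U) = ∫ (U ⊗ U) B (U ⊗ U)† dμ_H(U) for every B ∈ M_{N²}(ℂ). Then for every density matrix ρ on ℂ^N and every N×N complex Hermitian matrix O with ‖O‖_∞ ≤ 1, the variance of tr(O U ρ U†) over U ∼ ν is at most 1/(N+1): ∫ (tr(O U ρ U†))² dν(U) − (∫ tr(O U ρ U†) dν(U))² ≤ 1/(N+1). -/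
open MeasureTheory Matrix
open scoped Kronecker ComplexOrder

attribute [local instance] Matrix.frobeniusNormedAddCommGroup Matrix.frobeniusNormedSpace

noncomputable section

section Moments

open scoped ENNReal

variable {n : Type*}

section Integrability

variable {m l α : Type*} [MeasurableSpace α] {μ : Measure α}

/-- A matrix-valued function whose entries are all essentially bounded. -/
def EntrywiseBounded (μ : Measure α) (F : α → Matrix m n ℂ) : Prop :=
  ∀ i j, MemLp (fun x => F x i j) ∞ μ

theorem EntrywiseBounded.mul [Fintype n] {F : α → Matrix m n ℂ} {G : α → Matrix n l ℂ}
    (hF : EntrywiseBounded μ F) (hG : EntrywiseBounded μ G) :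
    EntrywiseBounded μ fun x => F x * G x := fun i j => by
  simp only [Matrix.mul_apply]
  exact memLp_finsetSum _ fun k _ => (hG k j).mul (hF i k)

theorem EntrywiseBounded.conjTranspose {F : α → Matrix m n ℂ} (hF : EntrywiseBounded μ F) :
    EntrywiseBounded μ fun x => (F x)ᴴ := fun i j => (hF j i).star

theorem EntrywiseBounded.kronecker {F : α → Matrix m n ℂ} (hF : EntrywiseBounded μ F) :
    EntrywiseBounded μ fun x => F x ⊗ₖ F x := fun i j => (hF i.2 j.2).mul (hF i.1 j.1)

theorem entrywiseBounded_const [IsFiniteMeasure μ] (A : Matrix m n ℂ) :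
    EntrywiseBounded μ fun _ => A := fun i j => memLp_const (A i j)

theorem integral_linearMap_sum_smul {E ι : Type*} [NormedAddCommGroup E] [NormedSpace ℂ E]
    [NormedSpace ℝ E] [FiniteDimensional ℂ E] [Fintype ι] {f : ι → α → ℂ}
    (hf : ∀ k, Integrable (f k) μ) (e : ι → E) (L : E →ₗ[ℂ] ℂ) :
    ∫ x, L (∑ k, f k x • e k) ∂μ = L (∫ x, ∑ k, f k x • e k ∂μ) :=
  haveI := FiniteDimensional.complete ℂ E
  (LinearMap.toContinuousLinearMap L).integral_comp_comm
    (integrable_finsetSum _ fun k _ => (hf k).smul_const (e k))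

theorem EntrywiseBounded.integral_linearMap [Fintype m] [Fintype n] [DecidableEq m]
    [DecidableEq n] [IsFiniteMeasure μ] {F : α → Matrix m n ℂ}
    (hF : EntrywiseBounded μ F) (L : Matrix m n ℂ →ₗ[ℂ] ℂ) :
    ∫ x, L (F x) ∂μ = L (∫ x, F x ∂μ) := by
  have h (x : α) : F x = ∑ k : m × n, F x k.1 k.2 • Matrix.single k.1 k.2 (1 : ℂ) := by
    conv_lhs => rw [Matrix.matrix_eq_sum_single (F x)]
    simp [Fintype.sum_prod_type]
  have h' := integral_linearMap_sum_smul (fun k : m × n => (hF k.1 k.2).integrable le_top)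
    (fun k => Matrix.single k.1 k.2 (1 : ℂ)) L
  simpa only [← h] using h'

end Integrability

variable [Fintype n]

theorem sum_sub_average_sq_le (a : n → ℝ) (ha : ∀ i, |a i| ≤ 1) :
    ∑ i, (a i - (∑ k, a k) / Fintype.card n) ^ 2 ≤ Fintype.card n := by
  rcases isEmpty_or_nonempty n with h | h
  · simp
  have hcard : (Fintype.card n : ℝ) ≠ 0 := by simp
  have hsq : ∑ i, a i ^ 2 ≤ Fintype.card n := by
    refine (Finset.sum_le_sum fun i _ => (sq_le_one_iff_abs_le_one (a i)).mpr (ha i)).trans ?_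
    simp
  have h' : ∑ i, (a i - (∑ k, a k) / Fintype.card n) ^ 2 =
      ∑ i, a i ^ 2 - (∑ k, a k) ^ 2 / Fintype.card n := by
    simp only [sub_sq, Finset.sum_add_distrib, Finset.sum_sub_distrib, ← Finset.sum_mul,
      ← Finset.mul_sum, Finset.sum_const, Finset.card_univ, nsmul_eq_mul]
    field_simp
    ring
  rw [h']
  have : 0 ≤ (∑ k, a k) ^ 2 / (Fintype.card n : ℝ) := by positivity
  linarith

variable [DecidableEq n]

/-- The real number `∑ i j, a i * p j * |M i j| ^ 2`, which is the trace of
`diagonal a * M * diagonal p * Mᴴ`. -/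
def diagonalForm (a p : n → ℝ) (M : Matrix n n ℂ) : ℝ :=
  ∑ j, p j * ∑ i, a i * Complex.normSq (M i j)

theorem trace_diagonal_mul_mul_diagonal_mul_conjTranspose (a p : n → ℝ) (M : Matrix n n ℂ) :
    (diagonal (fun i => (a i : ℂ)) * M * diagonal (fun j => (p j : ℂ)) * Mᴴ).trace =
      (diagonalForm a p M : ℂ) := by
  rw [diagonalForm, Finset.sum_congr rfl fun j _ => Finset.mul_sum _ _ _, Finset.sum_comm]
  simp only [trace, diag_apply, Matrix.mul_apply (N := Mᴴ), mul_diagonal, diagonal_mul,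
    conjTranspose_apply, Complex.ofReal_sum, Complex.ofReal_mul, ← Complex.mul_conj]
  refine Finset.sum_congr rfl fun i _ => Finset.sum_congr rfl fun j _ => ?_
  rw [Complex.star_def]
  ring

theorem Matrix.IsHermitian.eq_conj_diagonal {A : Matrix n n ℂ} (hA : A.IsHermitian) :
    A = (hA.eigenvectorUnitary : Matrix n n ℂ) * diagonal (fun i => (hA.eigenvalues i : ℂ)) *
      (hA.eigenvectorUnitary : Matrix n n ℂ)ᴴ := by
  conv_lhs => rw [hA.spectral_theorem, Unitary.conjStarAlgAut_apply]
  rfl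

theorem trace_mul_conj_eq_diagonalForm {A B : Matrix n n ℂ} (hA : A.IsHermitian)
    (hB : B.IsHermitian) (U : unitaryGroup n ℂ) :
    (A * (U : Matrix n n ℂ) * B * (U : Matrix n n ℂ)ᴴ).trace =
      (diagonalForm hA.eigenvalues hB.eigenvalues
        ((star hA.eigenvectorUnitary * U * hB.eigenvectorUnitary : unitaryGroup n ℂ) :
          Matrix n n ℂ) : ℂ) := by
  rw [← trace_diagonal_mul_mul_diagonal_mul_conjTranspose]
  conv_lhs => rw [hA.eq_conj_diagonal, hB.eq_conj_diagonal]
  simp only [Submonoid.coe_mul, Unitary.coe_star, star_eq_conjTranspose, conjTranspose_mul,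
    conjTranspose_conjTranspose, Matrix.mul_assoc]
  rw [Matrix.trace_mul_comm]
  simp only [Matrix.mul_assoc]

theorem Matrix.IsHermitian.abs_eigenvalues_le {A : Matrix n n ℂ} (hA : A.IsHermitian) (i : n) :
    |hA.eigenvalues i| ≤ ‖toEuclideanCLM (𝕜 := ℂ) A‖ := by
  have h := (toEuclideanCLM (𝕜 := ℂ) A).le_opNorm (hA.eigenvectorBasis i)
  have he : toEuclideanCLM (𝕜 := ℂ) A (hA.eigenvectorBasis i) =
      hA.eigenvalues i • hA.eigenvectorBasis i := by
    apply (WithLp.ofLp_injective 2)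
    rw [ofLp_toEuclideanCLM, hA.mulVec_eigenvectorBasis]
    rfl
  rwa [he, norm_smul, hA.eigenvectorBasis.norm_eq_one, mul_one, mul_one, Real.norm_eq_abs] at h

theorem measurable_unitaryGroup_apply (i j : n) :
    Measurable fun U : unitaryGroup n ℂ => (U : Matrix n n ℂ) i j := by
  have h : Measurable fun U : unitaryGroup n ℂ => (U : Matrix n n ℂ) := measurable_subtype_coe
  exact measurable_pi_iff.mp (measurable_pi_iff.mp h i) j

instance : MeasurableMul (unitaryGroup n ℂ) where
  measurable_const_mul V := by
    refine Measurable.subtype_mk (measurable_pi_lambda _ fun i =>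
      measurable_pi_lambda _ fun j => ?_)
    simp only [Matrix.mul_apply]
    exact Finset.measurable_sum _ fun k _ => (measurable_unitaryGroup_apply k j).const_mul _
  measurable_mul_const V := by
    refine Measurable.subtype_mk (measurable_pi_lambda _ fun i =>
      measurable_pi_lambda _ fun j => ?_)
    simp only [Matrix.mul_apply]
    exact Finset.measurable_sum _ fun k _ => (measurable_unitaryGroup_apply i k).mul_const _

theorem entrywiseBounded_unitaryGroup_coe (μ : Measure (unitaryGroup n ℂ)) :
    EntrywiseBounded μ fun U : unitaryGroup n ℂ => (U : Matrix n n ℂ) := fun i j =>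
  memLp_top_of_bound (measurable_unitaryGroup_apply i j).aestronglyMeasurable 1
    (ae_of_all _ fun U => entry_norm_bound_of_unitary U.2 i j)

theorem memLp_normSq_apply (μ : Measure (unitaryGroup n ℂ)) (i j : n) :
    MemLp (fun U : unitaryGroup n ℂ => Complex.normSq ((U : Matrix n n ℂ) i j)) ∞ μ :=
  memLp_top_of_bound
    (Complex.continuous_normSq.measurable.comp
      (measurable_unitaryGroup_apply i j)).aestronglyMeasurable 1
    (ae_of_all _ fun U => by
      have h := entry_norm_bound_of_unitary U.2 i j
      rw [Complex.normSq_eq_norm_sq, norm_pow, norm_norm]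
      exact pow_le_one₀ (norm_nonneg _) h)

theorem sum_normSq_col (U : unitaryGroup n ℂ) (j : n) :
    ∑ i, Complex.normSq ((U : Matrix n n ℂ) i j) = 1 := by
  have h := congrFun (congrFun (mem_unitaryGroup_iff'.mp U.2) j) j
  rw [star_eq_conjTranspose, Matrix.mul_apply, one_apply_eq] at h
  have h' : ((∑ i, Complex.normSq ((U : Matrix n n ℂ) i j) : ℝ) : ℂ) = 1 := by
    rw [← h, Complex.ofReal_sum]
    exact Finset.sum_congr rfl fun i _ => Complex.normSq_eq_conj_mul_self
  exact_mod_cast h'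

theorem one_sub_smul_vecMulVec_mem_unitaryGroup (z : n → ℂ) (hz : star z ⬝ᵥ z = 5) :
    1 - (2 / 5 : ℂ) • vecMulVec z (star z) ∈ unitaryGroup n ℂ := by
  have hs : star (1 - (2 / 5 : ℂ) • vecMulVec z (star z)) =
      1 - (2 / 5 : ℂ) • vecMulVec z (star z) := by
    rw [star_sub, star_smul, star_one, star_eq_conjTranspose, conjTranspose_vecMulVec, star_star]
    norm_num
  rw [mem_unitaryGroup_iff, hs]
  simp only [sub_mul, mul_sub, one_mul, mul_one, smul_mul_smul_comm, vecMulVec_mul_vecMulVec, hz]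
  rw [vecMulVec_smul]
  module

theorem exists_unitary_rotation {i k : n} (hik : i ≠ k) (w : ℂ) (hw : Complex.normSq w = 1) :
    ∃ V : unitaryGroup n ℂ, ∀ (M : Matrix n n ℂ) (j : n),
      ((V : Matrix n n ℂ) * M) i j = 3 / 5 * M i j - 4 / 5 * w * M k j := by
  have hww : w * starRingEnd ℂ w = 1 := by
    rw [Complex.mul_conj, hw, Complex.ofReal_one]
  refine ⟨⟨_, one_sub_smul_vecMulVec_mem_unitaryGroup
    (Pi.single i 1 + Pi.single k (2 * star w)) ?_⟩, fun M j => ?_⟩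
  · simp [dotProduct_add, hik, hik.symm, Pi.star_single]
    linear_combination 4 * hww
  · simp [sub_mul, vecMulVec_mul, vecMulVec_apply, hik, add_vecMul,
      Pi.star_single]
    ring

section Haar

variable (μ : Measure (unitaryGroup n ℂ))

/-- The second moment `∫ |U i j|² |U k j|²`. -/
def columnMoment (j i k : n) : ℝ :=
  ∫ U : unitaryGroup n ℂ, Complex.normSq ((U : Matrix n n ℂ) i j) *
    Complex.normSq ((U : Matrix n n ℂ) k j) ∂μ

theorem columnMoment_comm (j i k : n) : columnMoment μ j i k = columnMoment μ j k i := by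
  simp only [columnMoment, mul_comm]

variable [IsProbabilityMeasure μ]

theorem integrable_normSq_mul_normSq (j i k : n) :
    Integrable (fun U : unitaryGroup n ℂ => Complex.normSq ((U : Matrix n n ℂ) i j) *
      Complex.normSq ((U : Matrix n n ℂ) k j)) μ :=
  ((memLp_normSq_apply μ k j).mul (memLp_normSq_apply μ i j) (r := ∞)).integrable le_top

theorem sum_columnMoment (j : n) : ∑ i, ∑ k, columnMoment μ j i k = 1 := by
  simp only [columnMoment]
  rw [Finset.sum_congr rfl fun i _ => (integral_finsetSum _ fun k _ =>
      integrable_normSq_mul_normSq μ j i k).symm,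
    ← integral_finsetSum _ fun i _ => integrable_finsetSum _ fun k _ =>
      integrable_normSq_mul_normSq μ j i k]
  simp [← Finset.mul_sum, sum_normSq_col]

theorem sum_normSq_rotation_sq (x y : ℂ) :
    Complex.normSq (3 / 5 * x - 4 / 5 * 1 * y) ^ 2 +
        Complex.normSq (3 / 5 * x - 4 / 5 * (-1) * y) ^ 2 +
        Complex.normSq (3 / 5 * x - 4 / 5 * Complex.I * y) ^ 2 +
        Complex.normSq (3 / 5 * x - 4 / 5 * (-Complex.I) * y) ^ 2 =
      4 / 625 * (81 * (Complex.normSq x * Complex.normSq x) +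
        256 * (Complex.normSq y * Complex.normSq y) +
        576 * (Complex.normSq x * Complex.normSq y)) := by
  have h3 : (3 / 5 : ℂ) = ((3 / 5 : ℝ) : ℂ) := by norm_num
  have h4 : (4 / 5 : ℂ) = ((4 / 5 : ℝ) : ℂ) := by norm_num
  rw [h3, h4]
  simp only [Complex.normSq_apply, Complex.sub_re, Complex.sub_im, Complex.mul_re, Complex.mul_im,
    Complex.ofReal_re, Complex.ofReal_im, Complex.neg_re, Complex.neg_im, Complex.I_re,
    Complex.I_im, Complex.one_re, Complex.one_im]
  ring

variable [μ.IsMulLeftInvariant]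

theorem columnMoment_rotation (j : n) {i k : n} (hik : i ≠ k) :
    625 * columnMoment μ j i i =
      81 * columnMoment μ j i i + 256 * columnMoment μ j k k + 576 * columnMoment μ j i k := by
  have key (w : ℂ) (hw : Complex.normSq w = 1) :
      Integrable (fun U : unitaryGroup n ℂ =>
        Complex.normSq (3 / 5 * (U : Matrix n n ℂ) i j - 4 / 5 * w * (U : Matrix n n ℂ) k j) ^ 2) μ ∧
      ∫ U : unitaryGroup n ℂ,
        Complex.normSq (3 / 5 * (U : Matrix n n ℂ) i j - 4 / 5 * w * (U : Matrix n n ℂ) k j) ^ 2 ∂μ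
          = columnMoment μ j i i := by
    obtain ⟨V, hV⟩ := exists_unitary_rotation hik w hw
    simp only [← hV, columnMoment, sq, ← Submonoid.coe_mul]
    exact ⟨(integrable_normSq_mul_normSq μ j i i).comp_mul_left V,
      integral_mul_left_eq_self (fun U : unitaryGroup n ℂ =>
        Complex.normSq ((U : Matrix n n ℂ) i j) * Complex.normSq ((U : Matrix n n ℂ) i j)) V⟩
  obtain ⟨i1, e1⟩ := key 1 (by simp)
  obtain ⟨i2, e2⟩ := key (-1) (by simp)
  obtain ⟨i3, e3⟩ := key Complex.I (by simp)
  obtain ⟨i4, e4⟩ := key (-Complex.I) (by simp)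
  have hsum := integral_congr_ae (μ := μ) (ae_of_all _ fun U : unitaryGroup n ℂ =>
    sum_normSq_rotation_sq ((U : Matrix n n ℂ) i j) ((U : Matrix n n ℂ) k j))
  have hi := integrable_normSq_mul_normSq μ j
  rw [integral_add ((i1.fun_add i2).fun_add i3) i4, integral_add (i1.fun_add i2) i3,
    integral_add i1 i2,
    e1, e2, e3, e4, integral_const_mul,
    integral_add (((hi i i).const_mul _).fun_add ((hi k k).const_mul _)) ((hi i k).const_mul _),
    integral_add ((hi i i).const_mul _) ((hi k k).const_mul _), integral_const_mul,
    integral_const_mul, integral_const_mul] at hsum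
  simp only [columnMoment] at hsum ⊢
  linarith

theorem columnMoment_eq (j i k : n) :
    columnMoment μ j i k =
      (if i = k then 2 else 1) / (Fintype.card n * (Fintype.card n + 1)) := by
  have hdiag (i k : n) : columnMoment μ j i i = columnMoment μ j k k := by
    rcases eq_or_ne i k with rfl | h
    · rfl
    · have h1 := columnMoment_rotation μ j h
      have h2 := columnMoment_rotation μ j h.symm
      rw [columnMoment_comm μ j k i] at h2
      linarith
  obtain ⟨c, hc⟩ : ∃ c, ∀ i k, columnMoment μ j i k = c * (1 + if i = k then 1 else 0) := by
    refine ⟨columnMoment μ j j j / 2, fun i k => ?_⟩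
    split_ifs with h
    · rw [← h, hdiag i j]
      ring
    · have h1 := columnMoment_rotation μ j h
      have h2 := hdiag i j
      have h3 := hdiag k j
      linarith
  have hsum := sum_columnMoment μ j
  simp only [hc, ← Finset.mul_sum, Finset.sum_add_distrib, Finset.sum_ite_eq,
    Finset.mem_univ, if_true, Finset.sum_const, Finset.card_univ, nsmul_eq_mul, mul_one] at hsum
  have hcard : (0 : ℝ) < Fintype.card n := by
    exact_mod_cast Fintype.card_pos_iff.mpr ⟨j⟩
  have hc' : c = 1 / (Fintype.card n * (Fintype.card n + 1)) := by
    field_simp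
    linarith
  rw [hc, hc']
  split_ifs <;> ring

theorem integral_column_sq (d : n → ℝ) (hd : ∑ i, d i = 0) (j : n) :
    ∫ U : unitaryGroup n ℂ, (∑ i, d i * Complex.normSq ((U : Matrix n n ℂ) i j)) ^ 2 ∂μ =
      (∑ i, d i ^ 2) / (Fintype.card n * (Fintype.card n + 1)) := by
  have hint (i k : n) := (integrable_normSq_mul_normSq μ j i k).const_mul (d i * d k)
  have hexp (U : unitaryGroup n ℂ) :
      (∑ i, d i * Complex.normSq ((U : Matrix n n ℂ) i j)) ^ 2 =
        ∑ i, ∑ k, d i * d k * (Complex.normSq ((U : Matrix n n ℂ) i j) *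
          Complex.normSq ((U : Matrix n n ℂ) k j)) := by
    rw [sq, Finset.sum_mul_sum]
    exact Finset.sum_congr rfl fun i _ => Finset.sum_congr rfl fun k _ => by ring
  simp only [hexp]
  rw [integral_finsetSum _ fun i _ => integrable_finsetSum _ fun k _ => hint i k,
    Finset.sum_congr rfl fun i _ => integral_finsetSum _ fun k _ => hint i k]
  simp only [integral_const_mul]
  have hterm (i k : n) : d i * d k * ∫ U : unitaryGroup n ℂ,
      Complex.normSq ((U : Matrix n n ℂ) i j) * Complex.normSq ((U : Matrix n n ℂ) k j) ∂μ =
      (d i * d k + if i = k then d i * d k else 0) /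
        (Fintype.card n * (Fintype.card n + 1)) := by
    have h := columnMoment_eq μ j i k
    rw [columnMoment] at h
    rw [h]
    split_ifs <;> ring
  simp only [hterm, ← Finset.sum_div, Finset.sum_add_distrib, ← Finset.mul_sum, hd,
    Finset.sum_ite_eq, Finset.mem_univ, if_true, mul_zero, zero_add, sq]

end Haar

section Variance

variable (μ : Measure (unitaryGroup n ℂ))

theorem memLp_diagonalForm (a p : n → ℝ) :
    MemLp (fun U : unitaryGroup n ℂ => diagonalForm a p U) ∞ μ :=
  memLp_finsetSum _ fun j _ => (memLp_finsetSum _ fun i _ =>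
    (memLp_normSq_apply μ i j).const_mul (a i)).const_mul (p j)

variable [IsProbabilityMeasure μ]

theorem integral_diagonalForm_sq_le [μ.IsMulLeftInvariant] (d p : n → ℝ) (hd : ∑ i, d i = 0)
    (hp : ∀ j, 0 ≤ p j) (hp1 : ∑ j, p j = 1) :
    ∫ U : unitaryGroup n ℂ, diagonalForm d p U ^ 2 ∂μ ≤
      (∑ i, d i ^ 2) / (Fintype.card n * (Fintype.card n + 1)) := by
  have hcol (j : n) : MemLp (fun U : unitaryGroup n ℂ =>
      ∑ i, d i * Complex.normSq ((U : Matrix n n ℂ) i j)) ∞ μ :=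
    memLp_finsetSum _ fun i _ => (memLp_normSq_apply μ i j).const_mul (d i)
  have hint (j : n) : Integrable (fun U : unitaryGroup n ℂ =>
      p j * (∑ i, d i * Complex.normSq ((U : Matrix n n ℂ) i j)) ^ 2) μ := by
    simp only [sq]
    exact (((hcol j).mul' (hcol j) (r := ∞)).integrable le_top).const_mul _
  calc ∫ U : unitaryGroup n ℂ, diagonalForm d p U ^ 2 ∂μ
      ≤ ∫ U : unitaryGroup n ℂ,
          ∑ j, p j * (∑ i, d i * Complex.normSq ((U : Matrix n n ℂ) i j)) ^ 2 ∂μ := by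
        refine integral_mono ?_ (integrable_finsetSum _ fun j _ => hint j) fun U => ?_
        · simp only [sq]
          exact ((memLp_diagonalForm μ d p).mul' (memLp_diagonalForm μ d p)
            (r := ∞)).integrable le_top
        · exact (even_two.convexOn_pow (𝕜 := ℝ)).map_sum_le (fun j _ => hp j) hp1
            fun j _ => Set.mem_univ _
    _ = (∑ i, d i ^ 2) / (Fintype.card n * (Fintype.card n + 1)) := by
        rw [integral_finsetSum _ fun j _ => hint j]
        simp only [integral_const_mul, integral_column_sq μ d hd, ← Finset.sum_mul, hp1, one_mul]

theorem diagonalForm_sub_const (a p : n → ℝ) (c : ℝ) (hp1 : ∑ j, p j = 1)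
    (U : unitaryGroup n ℂ) :
    diagonalForm (fun i => a i - c) p U = diagonalForm a p U - c := by
  simp only [diagonalForm, sub_mul, Finset.sum_sub_distrib, ← Finset.mul_sum, sum_normSq_col,
    mul_sub, mul_one, ← Finset.sum_mul, hp1, one_mul]

theorem variance_diagonalForm_le [Nonempty n] [μ.IsMulLeftInvariant] (a p : n → ℝ)
    (ha : ∀ i, |a i| ≤ 1) (hp : ∀ j, 0 ≤ p j) (hp1 : ∑ j, p j = 1) :
    ∫ U : unitaryGroup n ℂ, diagonalForm a p U ^ 2 ∂μ -
        (∫ U : unitaryGroup n ℂ, diagonalForm a p U ∂μ) ^ 2 ≤ 1 / ((Fintype.card n : ℝ) + 1) := by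
  have hcard : (0 : ℝ) < Fintype.card n := by exact_mod_cast Fintype.card_pos
  set c := (∑ k, a k) / Fintype.card n with hc
  have hd : ∑ i, (a i - c) = 0 := by
    rw [Finset.sum_sub_distrib, Finset.sum_const, Finset.card_univ, nsmul_eq_mul, hc]
    field_simp
    ring
  have hX := memLp_diagonalForm μ a p
  calc _ = ProbabilityTheory.variance (fun U : unitaryGroup n ℂ => diagonalForm a p U) μ :=
        (ProbabilityTheory.variance_eq_sub (hX.mono_exponent le_top)).symm
    _ = ProbabilityTheory.variance (fun U : unitaryGroup n ℂ => diagonalForm a p U - c) μ :=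
        (ProbabilityTheory.variance_sub_const hX.aestronglyMeasurable c).symm
    _ ≤ ∫ U : unitaryGroup n ℂ, (diagonalForm a p U - c) ^ 2 ∂μ :=
        ProbabilityTheory.variance_le_expectation_sq
          (hX.aestronglyMeasurable.sub aestronglyMeasurable_const)
    _ = ∫ U : unitaryGroup n ℂ, diagonalForm (fun i => a i - c) p U ^ 2 ∂μ := by
        simp only [diagonalForm_sub_const a p c hp1]
    _ ≤ (∑ i, (a i - c) ^ 2) / (Fintype.card n * (Fintype.card n + 1)) :=
        integral_diagonalForm_sq_le μ _ p hd hp hp1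
    _ ≤ Fintype.card n / (Fintype.card n * (Fintype.card n + 1)) := by
        gcongr
        exact sum_sub_average_sq_le a ha
    _ = 1 / ((Fintype.card n : ℝ) + 1) := by
        field_simp

theorem variance_trace_mul_conj_le [Nonempty n] [μ.IsMulLeftInvariant] [μ.IsMulRightInvariant]
    {A B : Matrix n n ℂ} (hA : A.IsHermitian) (hA1 : ‖toEuclideanCLM (𝕜 := ℂ) A‖ ≤ 1)
    (hB : B.PosSemidef) (hB1 : B.trace = 1) :
    ∫ U : unitaryGroup n ℂ,
        ((A * (U : Matrix n n ℂ) * B * (U : Matrix n n ℂ)ᴴ).trace.re) ^ 2 ∂μ -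
      (∫ U : unitaryGroup n ℂ,
        (A * (U : Matrix n n ℂ) * B * (U : Matrix n n ℂ)ᴴ).trace.re ∂μ) ^ 2 ≤
      1 / ((Fintype.card n : ℝ) + 1) := by
  have hp1 : ∑ j, hB.1.eigenvalues j = 1 := by
    have h := hB.1.trace_eq_sum_eigenvalues
    rw [hB1] at h
    apply Complex.ofReal_injective
    push_cast
    exact h.symm
  have hinv (f : unitaryGroup n ℂ → ℝ) :
      ∫ U, f (star hA.eigenvectorUnitary * U * hB.1.eigenvectorUnitary) ∂μ = ∫ U, f U ∂μ :=
    (integral_mul_left_eq_self (fun U => f (U * hB.1.eigenvectorUnitary)) _).trans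
      (integral_mul_right_eq_self f _)
  simp only [trace_mul_conj_eq_diagonalForm hA hB.1, Complex.ofReal_re]
  rw [hinv fun U => diagonalForm hA.eigenvalues hB.1.eigenvalues U ^ 2,
    hinv fun U => diagonalForm hA.eigenvalues hB.1.eigenvalues U]
  exact variance_diagonalForm_le μ _ _ (fun i => (hA.abs_eigenvalues_le i).trans hA1)
    hB.eigenvalues_nonneg hp1

theorem ofReal_integral_trace_mul_conj {A B : Matrix n n ℂ} (hA : A.IsHermitian)
    (hB : B.IsHermitian) :
    ((∫ U : unitaryGroup n ℂ,
        (A * (U : Matrix n n ℂ) * B * (U : Matrix n n ℂ)ᴴ).trace.re ∂μ : ℝ) : ℂ) =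
      (A * ∫ U : unitaryGroup n ℂ, (U : Matrix n n ℂ) * B * (U : Matrix n n ℂ)ᴴ ∂μ).trace := by
  have hU := entrywiseBounded_unitaryGroup_coe μ
  refine Eq.trans ?_ (((hU.mul (entrywiseBounded_const B)).mul hU.conjTranspose).integral_linearMap
    (traceLinearMap n ℂ ℂ ∘ₗ LinearMap.mulLeft ℂ A))
  rw [← integral_complex_ofReal]
  refine integral_congr_ae (ae_of_all _ fun U => ?_)
  simp only [trace_mul_conj_eq_diagonalForm hA hB, Complex.ofReal_re, LinearMap.comp_apply,
    LinearMap.mulLeft_apply, traceLinearMap_apply, ← Matrix.mul_assoc]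

theorem ofReal_integral_trace_mul_conj_sq {A B : Matrix n n ℂ} (hA : A.IsHermitian)
    (hB : B.IsHermitian) :
    ((∫ U : unitaryGroup n ℂ,
        ((A * (U : Matrix n n ℂ) * B * (U : Matrix n n ℂ)ᴴ).trace.re) ^ 2 ∂μ : ℝ) : ℂ) =
      ((A ⊗ₖ A) * ∫ U : unitaryGroup n ℂ, ((U : Matrix n n ℂ) ⊗ₖ (U : Matrix n n ℂ)) * (B ⊗ₖ B) *
        ((U : Matrix n n ℂ) ⊗ₖ (U : Matrix n n ℂ))ᴴ ∂μ).trace := by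
  have hU := (entrywiseBounded_unitaryGroup_coe μ).kronecker
  refine Eq.trans ?_ (((hU.mul (entrywiseBounded_const (B ⊗ₖ B))).mul
    hU.conjTranspose).integral_linearMap
    (traceLinearMap (n × n) ℂ ℂ ∘ₗ LinearMap.mulLeft ℂ (A ⊗ₖ A)))
  rw [← integral_complex_ofReal]
  refine integral_congr_ae (ae_of_all _ fun U => ?_)
  simp only [LinearMap.comp_apply, LinearMap.mulLeft_apply, traceLinearMap_apply,
    conjTranspose_kronecker, ← mul_kronecker_mul, trace_kronecker, ← Matrix.mul_assoc]
  simp only [trace_mul_conj_eq_diagonalForm hA hB, Complex.ofReal_re, Complex.ofReal_mul, sq]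

end Variance

end Moments


/-- Let `ν` be a Borel probability measure on `U(N)` (`N ≥ 2`) that is an exact
unitary 2-design (its first and second moments of conjugation agree with those of the Haar
measure `μH`). Then for every density matrix `ρ` and every Hermitian `O` with `‖O‖_∞ ≤ 1`,
the variance of `tr(O U ρ U†)` over `U ∼ ν` is at most `1/(N+1)`. -/
theorem variance_expectation_value_two_design (N : ℕ) (hN : 2 ≤ N)
    (μH ν : Measure (Matrix.unitaryGroup (Fin N) ℂ))
    [IsProbabilityMeasure μH] [μH.IsMulLeftInvariant] [μH.IsMulRightInvariant]
    [IsProbabilityMeasure ν]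
    (hdesign1 : ∀ A : Matrix (Fin N) (Fin N) ℂ,
      (∫ U : Matrix.unitaryGroup (Fin N) ℂ,
          (U : Matrix (Fin N) (Fin N) ℂ) * A * (U : Matrix (Fin N) (Fin N) ℂ)ᴴ ∂ν)
        = ∫ U : Matrix.unitaryGroup (Fin N) ℂ,
            (U : Matrix (Fin N) (Fin N) ℂ) * A * (U : Matrix (Fin N) (Fin N) ℂ)ᴴ ∂μH)
    (hdesign2 : ∀ B : Matrix (Fin N × Fin N) (Fin N × Fin N) ℂ,
      (∫ U : Matrix.unitaryGroup (Fin N) ℂ,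
          ((U : Matrix (Fin N) (Fin N) ℂ) ⊗ₖ (U : Matrix (Fin N) (Fin N) ℂ)) * B *
            ((U : Matrix (Fin N) (Fin N) ℂ) ⊗ₖ (U : Matrix (Fin N) (Fin N) ℂ))ᴴ ∂ν)
        = ∫ U : Matrix.unitaryGroup (Fin N) ℂ,
            ((U : Matrix (Fin N) (Fin N) ℂ) ⊗ₖ (U : Matrix (Fin N) (Fin N) ℂ)) * B *
              ((U : Matrix (Fin N) (Fin N) ℂ) ⊗ₖ (U : Matrix (Fin N) (Fin N) ℂ))ᴴ ∂μH)
    (ρ O : Matrix (Fin N) (Fin N) ℂ)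
    (hρ : ρ.PosSemidef) (hρtr : ρ.trace = 1) (hO : O.IsHermitian)
    (hOnorm : ‖Matrix.toEuclideanCLM (𝕜 := ℂ) O‖ ≤ 1) :
    (∫ U : Matrix.unitaryGroup (Fin N) ℂ,
        ((Matrix.trace (O * (U : Matrix (Fin N) (Fin N) ℂ) * ρ *
          (U : Matrix (Fin N) (Fin N) ℂ)ᴴ)).re) ^ 2 ∂ν)
      - (∫ U : Matrix.unitaryGroup (Fin N) ℂ,
          (Matrix.trace (O * (U : Matrix (Fin N) (Fin N) ℂ) * ρ *
            (U : Matrix (Fin N) (Fin N) ℂ)ᴴ)).re ∂ν) ^ 2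
      ≤ 1 / ((N : ℝ) + 1) := by
  have : Nonempty (Fin N) := ⟨⟨0, by lia⟩⟩
  have h1 := ofReal_integral_trace_mul_conj ν hO hρ.1
  have h2 := ofReal_integral_trace_mul_conj_sq ν hO hρ.1
  rw [hdesign1, ← ofReal_integral_trace_mul_conj μH hO hρ.1] at h1
  rw [hdesign2, ← ofReal_integral_trace_mul_conj_sq μH hO hρ.1] at h2
  rw [Complex.ofReal_injective h1, Complex.ofReal_injective h2]
  simpa only [Fintype.card_fin] using variance_trace_mul_conj_le μH hO hOnorm hρ hρtr

end
end
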